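/- Let n be a positive integer and let v = (r, d, a) be an integer triple with r ≥ 2, d > 0, a ≥ 2, v² = 2nd² − 2ra ≥ −2, and n ≥ 2r. Then D_v = ∅. -/

import Mathlib

/-- Mukai square of the triple `(r, d, a)` on a K3 surface with `H² = 2n`:
`v² = 2nd² − 2ra`. -/
def mukaiSq (n r d a : ℤ) : ℤ := 2 * n * d ^ 2 - 2 * r * a

/-- Mukai pairing `⟨(r,d,a), (r₁,d₁,a₁)⟩ = 2ndd₁ − ra₁ − r₁a`. -/
def mukaiPair (n r d a r₁ d₁ a₁ : ℤ) : ℤ := 2 * n * d * d₁ - r * a₁ - r₁ * a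

/-- `(r₁, d₁, a₁) ∈ D_{(r,d,a)}`. -/
def memD (n r d a r₁ d₁ a₁ : ℤ) : Prop :=
  (mukaiSq n r₁ d₁ a₁ = 0 ∨ mukaiSq n r₁ d₁ a₁ = -2) ∧
  0 < d₁ ∧ d₁ ≤ d ∧
  mukaiPair n r d a r₁ d₁ a₁ < mukaiSq n r₁ d₁ a₁ + 2 ∧
  0 < (a₁ * d - a * d₁) * (r₁ * d - r * d₁)

/-- `(r₁, d₁, a₁) ∈ D_{(r,d,a)}^{BN}`. -/
def memDBN (n r d a r₁ d₁ a₁ : ℤ) : Prop :=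
  memD n r d a r₁ d₁ a₁ ∧
  0 < d * r₁ - d₁ * r ∧ d * r₁ - d₁ * r ≤ d * a₁ - d₁ * a

/-- If `x y > 0`, then `4 r a ≤ (r y + a x)²` whenever `r a ≥ 0`. -/
lemma four_mul_le_sq_of_mul_pos {r a x y : ℤ} (hra : 0 ≤ r * a) (hxy : 0 < x * y) :
    4 * (r * a) ≤ (r * y + a * x) ^ 2 := by
  nlinarith [sq_nonneg (r * y - a * x), mul_nonneg hra (sub_nonneg.2 (Int.add_one_le_iff.2 hxy))]

/-- The numerical constraints coming from an isotropic class in `D_v` are contradictory. -/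
lemma isotropic_constraints_absurd {n d d₁ e T : ℤ} (hn : 4 ≤ n) (hd₁ : 0 < d₁) (hd₁d : d₁ ≤ d)
    (he : -1 ≤ e) (hlow : 2 * e * d₁ - d ≤ T) (hpos : 0 < e * d₁ ^ 2 - d₁ * T)
    (hsq : 4 * (n * d ^ 2 - e) ≤ T ^ 2) : False := by
  have hT : T < e * d₁ := by
    have : 0 < d₁ * (e * d₁ - T) := by linarith
    linarith [pos_of_mul_pos_right this hd₁.le]
  have hed : e < d := by nlinarith
  have hup : T < d := by linarith
  have hlow' : -(3 * d) ≤ T := by nlinarith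
  nlinarith [mul_nonneg (sub_nonneg.2 hn) (sq_nonneg d)]

/-- The numerical constraints coming from a spherical class in `D_v` with `r₁ d > r d₁` are
contradictory. -/
lemma spherical_constraints_absurd {n r d a r₁ d₁ e x y : ℤ} (hr : 2 ≤ r) (ha : 0 < a)
    (hn : 2 * r ≤ n) (hd₁ : 0 < d₁) (hd₁d : d₁ ≤ d) (hx : 0 < x) (hy : 0 < y)
    (hx' : x = r₁ * d - r * d₁) (hra : r * a = n * d ^ 2 - e)
    (hlow : 2 * e * d₁ + d ≤ r * y + a * x)
    (hxy : x * y = d ^ 2 + e * d₁ ^ 2 - d₁ * (r * y + a * x)) : False := by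
  have hd : 0 < d := by linarith
  have hxy0 : 0 < x * y := mul_pos hx hy
  have he : e * d₁ ^ 2 + d * d₁ < d ^ 2 := by nlinarith
  have he' : e < d ^ 2 := by
    by_contra! h
    nlinarith [mul_pos hd hd₁, mul_pos hd₁ hd₁, sq_nonneg d]
  have hax : a * (d₁ * x) < d ^ 2 + e * d₁ ^ 2 := by
    nlinarith [mul_pos hd₁ (mul_pos (by linarith : 0 < r) hy)]
  have hrax : (r * a) * (d₁ * x) < r * (d ^ 2 + e * d₁ ^ 2) := by
    nlinarith
  have hra2 : 2 * r * d ^ 2 - e ≤ r * a := by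
    nlinarith [mul_nonneg (sub_nonneg.2 hn) (sq_nonneg d)]
  have hra0 : 0 < r * a := mul_pos (by linarith) ha
  have hdx : d₁ * x < 2 := by
    by_contra! h
    have h₁ : (r * a) * 2 ≤ (r * a) * (d₁ * x) := mul_le_mul_of_nonneg_left h hra0.le
    have h₂ : r * (d ^ 2 + e * d₁ ^ 2) ≤ r * (2 * d ^ 2) :=
      mul_le_mul_of_nonneg_left (by nlinarith [mul_pos hd hd₁]) (by linarith)
    nlinarith [mul_nonneg (sub_nonneg.2 hr) (sq_nonneg d)]
  have hx1 : x = 1 := by nlinarith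
  have hd1 : d₁ = 1 := by nlinarith
  subst hx1 hd1
  have hdr : d ≤ r + 1 := by
    have hr₁ : 0 < r₁ := pos_of_mul_pos_left (by linarith : 0 < r₁ * d) hd.le
    nlinarith
  nlinarith [mul_le_mul_of_nonneg_left (by linarith : e ≤ d ^ 2 - d - 1)
    (by linarith : 0 ≤ r + 1)]

/-- if `r ≥ 2`, `d > 0`, `a ≥ 2`, `v² ≥ −2` and `n ≥ 2r`, then
`D_v = ∅`. -/
theorem D_empty_of_n_ge_two_r (n r d a : ℤ) (hn : 0 < n) (hr : 2 ≤ r)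
    (hd : 0 < d) (ha : 2 ≤ a) (hv : -2 ≤ mukaiSq n r d a) (hn2r : 2 * r ≤ n) :
    ∀ r₁ d₁ a₁ : ℤ, ¬ memD n r d a r₁ d₁ a₁ := by
  rintro r₁ d₁ a₁ ⟨hsq, hd₁, hd₁d, hpair, hxy⟩
  unfold mukaiSq at hv hsq hpair
  unfold mukaiPair at hpair
  obtain ⟨e, hra⟩ : ∃ e, r * a = n * d ^ 2 - e := ⟨n * d ^ 2 - r * a, by ring⟩
  have he : -1 ≤ e := by linarith
  have hra0 : 0 < r * a := mul_pos (by linarith) (by linarith)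
  obtain ⟨x, hx⟩ : ∃ x, x = r₁ * d - r * d₁ := ⟨_, rfl⟩
  obtain ⟨y, hy⟩ : ∃ y, y = a₁ * d - a * d₁ := ⟨_, rfl⟩
  rw [← hx, ← hy, mul_comm] at hxy
  have hT : r * y + a * x = d * (r * a₁ + r₁ * a) - 2 * (n * d ^ 2 - e) * d₁ := by
    rw [← hra, hx, hy]; ring
  have hprod : x * y = r₁ * a₁ * d ^ 2 - (n * d ^ 2 - e) * d₁ ^ 2 - d₁ * (r * y + a * x) := by
    rw [← hra, hx, hy]; ring
  have hbound := four_mul_le_sq_of_mul_pos hra0.le hxy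
  rcases hsq with h | h
  · have h₁ : r₁ * a₁ = n * d₁ ^ 2 := by linarith
    rw [h₁] at hprod
    refine isotropic_constraints_absurd (n := n) (T := r * y + a * x) (by linarith) hd₁ hd₁d he
      ?_ (by linarith) (hra ▸ hbound)
    have hk : 2 * n * d * d₁ - 1 ≤ r * a₁ + r₁ * a := by linarith
    linarith [mul_le_mul_of_nonneg_left hk hd.le]
  · have h₁ : r₁ * a₁ = n * d₁ ^ 2 + 1 := by linarith
    rw [h₁] at hprod
    have hk : 2 * n * d * d₁ + 1 ≤ r * a₁ + r₁ * a := by linarith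
    have hlow : 2 * e * d₁ + d ≤ r * y + a * x := by
      linarith [mul_le_mul_of_nonneg_left hk hd.le]
    rcases pos_and_pos_or_neg_and_neg_of_mul_pos hxy with ⟨hx0, hy0⟩ | ⟨hx0, hy0⟩
    · exact spherical_constraints_absurd hr (by linarith) hn2r hd₁ hd₁d hx0 hy0 hx hra hlow
        (by linarith)
    · have hneg : r * y + a * x < 0 := by nlinarith
      have he0 : e < 0 := by
        by_contra! h0
        nlinarith
      have hge : -d ≤ r * y + a * x := by nlinarith
      nlinarith
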